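/- Let Ω be a finite linearly ordered type, let G be a subgroup of Equiv.Perm Ω, and let L : List Ω be a nonempty list. Let m be the least element of the orbit {σ (L.head) : σ ∈ G}, and let g ∈ G satisfy g (L.head) = m. Then the minimal image of L under G equals the lexicographically least element of the set {(L.map g).map k : k ∈ G and k m = m}; that is, minimising over all of G is equivalent to first mapping the head to m and then minimising over the stabilizer of m in G. -/

import Mathlib

/-- The minimal image of a list `L` under a subgroup `G` of the symmetric group on `Ω`:
the lexicographically least element of `{L.map σ : σ ∈ G}`. -/
noncomputable def minListImage {Ω : Type*} [Fintype Ω] [LinearOrder Ω]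
    (G : Subgroup (Equiv.Perm Ω)) (L : List Ω) : List Ω :=
  letI : Fintype G := Fintype.ofFinite G
  (Finset.univ.image (fun σ : G => L.map ⇑(σ : Equiv.Perm Ω))).min'
    (Finset.univ_nonempty.image _)

/-- The least element of the orbit `{σ x : σ ∈ G}` of a point `x : Ω` under `G`. -/
noncomputable def orbitMin {Ω : Type*} [Fintype Ω] [LinearOrder Ω]
    (G : Subgroup (Equiv.Perm Ω)) (x : Ω) : Ω :=
  letI : Fintype G := Fintype.ofFinite G
  (Finset.univ.image (fun σ : G => (σ : Equiv.Perm Ω) x)).min'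
    (Finset.univ_nonempty.image _)

/-- The lexicographically least element of `{M.map k : k ∈ G, k m = m}`, i.e. the minimal
image of `M` under the stabilizer of `m` in `G`. -/
noncomputable def stabMinImage {Ω : Type*} [Fintype Ω] [LinearOrder Ω]
    (G : Subgroup (Equiv.Perm Ω)) (m : Ω) (M : List Ω) : List Ω :=
  letI : Fintype G := Fintype.ofFinite G
  ((Finset.univ.filter (fun k : G => (k : Equiv.Perm Ω) m = m)).image
      (fun k : G => M.map ⇑(k : Equiv.Perm Ω))).min'
    (Finset.Nonempty.image
      ⟨1, Finset.mem_filter.mpr ⟨Finset.mem_univ _, by simp⟩⟩ _)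

section MinimalImage

variable {Ω : Type*} [Fintype Ω] [LinearOrder Ω] {G : Subgroup (Equiv.Perm Ω)}

theorem minListImage_le (L : List Ω) (σ : G) :
    minListImage G L ≤ L.map ⇑(σ : Equiv.Perm Ω) := by
  let : Fintype G := Fintype.ofFinite G
  exact Finset.min'_le _ _ (Finset.mem_image_of_mem _ (Finset.mem_univ σ))

theorem le_minListImage {L M : List Ω}
    (h : ∀ σ : G, M ≤ L.map ⇑(σ : Equiv.Perm Ω)) : M ≤ minListImage G L := by
  let : Fintype G := Fintype.ofFinite G
  refine Finset.le_min' _ _ _ fun N hN => ?_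
  obtain ⟨σ, -, rfl⟩ := Finset.mem_image.mp hN
  exact h σ

theorem orbitMin_le (x : Ω) (σ : G) : orbitMin G x ≤ (σ : Equiv.Perm Ω) x := by
  let : Fintype G := Fintype.ofFinite G
  exact Finset.min'_le _ _
    (Finset.mem_image_of_mem (fun σ : G => (σ : Equiv.Perm Ω) x) (Finset.mem_univ σ))

theorem stabMinImage_le {m : Ω} (M : List Ω) (k : G) (hk : (k : Equiv.Perm Ω) m = m) :
    stabMinImage G m M ≤ M.map ⇑(k : Equiv.Perm Ω) := by
  let : Fintype G := Fintype.ofFinite G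
  exact Finset.min'_le _ _
    (Finset.mem_image_of_mem _ (Finset.mem_filter.mpr ⟨Finset.mem_univ k, hk⟩))

theorem le_stabMinImage {m : Ω} {M N : List Ω}
    (h : ∀ k : G, (k : Equiv.Perm Ω) m = m → N ≤ M.map ⇑(k : Equiv.Perm Ω)) :
    N ≤ stabMinImage G m M := by
  let : Fintype G := Fintype.ofFinite G
  refine Finset.le_min' _ _ _ fun K hK => ?_
  obtain ⟨k, hk, rfl⟩ := Finset.mem_image.mp hK
  exact h k (Finset.mem_filter.mp hk).2

end MinimalImage

theorem minListImage_eq_stabMinImage {Ω : Type*} [Fintype Ω] [LinearOrder Ω]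
    (G : Subgroup (Equiv.Perm Ω)) (L : List Ω) (hL : L ≠ [])
    (m : Ω) (hm : m = orbitMin G (L.head hL))
    (g : G) (hg : (g : Equiv.Perm Ω) (L.head hL) = m) :
    minListImage G L = stabMinImage G m (L.map ⇑(g : Equiv.Perm Ω)) := by
  apply le_antisymm
  · refine le_stabMinImage fun k _ => ?_
    simpa [List.map_map] using minListImage_le L (k * g)
  · refine le_minListImage fun σ => ?_
    have hσ : m ≤ (σ : Equiv.Perm Ω) (L.head hL) := hm ▸ orbitMin_le _ σ
    rcases hσ.eq_or_lt with hσ | hσ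
    · have hk : ((σ * g⁻¹ : G) : Equiv.Perm Ω) m = m := by
        simpa [← hg] using hσ.symm
      refine (stabMinImage_le _ _ hk).trans_eq ?_
      simp [List.map_map, Function.comp_def]
    · refine (stabMinImage_le _ 1 rfl).trans (le_of_lt ?_)
      cases L with
      | nil => exact absurd rfl hL
      | cons a t =>
        rw [← hg] at hσ
        simpa using List.Lex.rel hσ
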